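/- Let X be a random variable over {0,1}^n, let k be a real parameter with K := 2^k, and let T ⊆ support(X) be a set with max_{x∈T} Pr[X=x] ≤ 1/K. For any real ℓ ∈ [0,k] and real g ≥ 0 such that m := k − ℓ + g is a (nonnegative) integer, and any ε ∈ (0,1], if f : {0,1}^n → {0,1}^m is a uniformly random function, then Pr_f[ ∃ S ⊆ {0,1}^m with density μ := |S|/M such that Pr_X[f(X) ∈ S and X ∈ T] > μ·G + ε ] ≤ 2^{−(εK/2)·( g − (1/L)·log₂(2eG/ε) − log₂ e )}, where G := 2^g, L := 2^ℓ, M := 2^m. -/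

import Mathlib

open Finset Real
open scoped Classical

/-- Bit strings of length `n`, i.e. `{0,1}^n`. -/
abbrev BS (n : ℕ) := Fin n → Bool

/-- `p` is a probability mass function on a finite type. -/
def IsDist {α : Type*} [Fintype α] (p : α → ℝ) : Prop :=
  (∀ a, 0 ≤ p a) ∧ ∑ a, p a = 1

/-- Pushforward of a mass function `p` on `{0,1}^n` along `f : {0,1}^n → {0,1}^m`:
the distribution of `f(X)` when `X ∼ p`. -/
noncomputable def pushforward {n m : ℕ} (f : BS n → BS m) (p : BS n → ℝ) : BS m → ℝ :=
  fun v => ∑ x ∈ Finset.univ.filter (fun x => f x = v), p x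

/-- Statistical (total variation) distance between two mass functions. -/
noncomputable def SD {α : Type*} [Fintype α] (p q : α → ℝ) : ℝ :=
  (∑ a, |p a - q a|) / 2

/-- The `ε`-smooth min-entropy of the mass function `p`: the supremum of all `k'`
such that `p` is `ε`-close (in statistical distance) to some distribution with
min-entropy at least `k'` (i.e., all point masses at most `2^(-k')`). -/
noncomputable def smoothMinEntropy {α : Type*} [Fintype α] (p : α → ℝ) (ε : ℝ) : ℝ :=
  sSup {k' : ℝ | ∃ q : α → ℝ, IsDist q ∧ SD p q ≤ ε ∧ ∀ a, q a ≤ (2 : ℝ) ^ (-k')}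

/-- Probability, over a uniformly random function `f : {0,1}^n → {0,1}^m`,
that the predicate `P f` holds. -/
noncomputable def prF (n m : ℕ) (P : (BS n → BS m) → Prop) : ℝ :=
  ((Finset.univ.filter (fun f => P f)).card : ℝ) / (Fintype.card (BS n → BS m) : ℝ)

/-- Probability, over `X ∼ p`, of the event `A`. -/
noncomputable def prX {n : ℕ} (p : BS n → ℝ) (A : BS n → Prop) : ℝ :=
  ∑ x ∈ Finset.univ.filter (fun x => A x), p x

/-- The support of a mass function `p` on `{0,1}^n`. -/
noncomputable def supp {n : ℕ} (p : BS n → ℝ) : Finset (BS n) :=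
  Finset.univ.filter (fun x => 0 < p x)

theorem prF_le_one (n m : ℕ) (P : (BS n → BS m) → Prop) : prF n m P ≤ 1 := by
  unfold prF
  refine div_le_one_of_le₀ ?_ (Nat.cast_nonneg _)
  exact_mod_cast Finset.card_le_univ _

/-- Union bound for a uniformly random function. -/
theorem prF_exists_le_sum {ι : Type*} [Fintype ι] (n m : ℕ)
    (P : ι → (BS n → BS m) → Prop) :
    prF n m (fun f => ∃ i, P i f) ≤ ∑ i, prF n m (P i) := by
  unfold prF
  rw [← Finset.sum_div]
  refine div_le_div_of_nonneg_right ?_ (Nat.cast_nonneg _)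
  norm_cast
  refine le_trans (Finset.card_le_card fun f hf => ?_) Finset.card_biUnion_le
  simpa using hf

/-- Markov's inequality for a uniformly random function. -/
theorem prF_le_of_sum_le {n m : ℕ} {P : (BS n → BS m) → Prop} {Y : (BS n → BS m) → ℝ} {b c : ℝ}
    (hY : ∀ f, 0 ≤ Y f) (hb : 0 < b) (hPb : ∀ f, P f → b ≤ Y f)
    (hsum : ∑ f, Y f ≤ Fintype.card (BS n → BS m) * c) :
    prF n m P ≤ c / b := by
  unfold prF
  have hcard : (0 : ℝ) < Fintype.card (BS n → BS m) := by exact_mod_cast Fintype.card_pos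
  rw [div_le_div_iff₀ hcard hb, mul_comm c]
  refine le_trans ?_ hsum
  calc (#(univ.filter fun f => P f) : ℝ) * b = ∑ f ∈ univ.filter (fun f => P f), b := by
        rw [Finset.sum_const, nsmul_eq_mul]
    _ ≤ ∑ f ∈ univ.filter (fun f => P f), Y f :=
        Finset.sum_le_sum fun f hf => hPb f (Finset.mem_filter.1 hf).2
    _ ≤ ∑ f, Y f :=
        Finset.sum_le_sum_of_subset_of_nonneg (Finset.subset_univ _) fun f _ _ => hY f

/-- Bound on the moment generating function, at `log G`, of the `K`-scaled mass that a uniformly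
random function sends from `T` into `S`. -/
theorem sum_rpow_prX_le {n m : ℕ} {p : BS n → ℝ} {T : Finset (BS n)} (S : Finset (BS m))
    {K G : ℝ} (hp : IsDist p) (hK : 0 < K) (hT : ∀ x ∈ T, K * p x ≤ 1) (hG : 1 ≤ G) :
    ∑ f : BS n → BS m, G ^ (K * prX p (fun x => f x ∈ S ∧ x ∈ T)) ≤
      Fintype.card (BS n → BS m) * exp (K * (S.card / (2 : ℝ) ^ m * G)) := by
  have hG0 : 0 < G := by linarith
  have hM : (0 : ℝ) < 2 ^ m := by positivity
  have hprod : ∀ f : BS n → BS m, G ^ (K * prX p (fun x => f x ∈ S ∧ x ∈ T)) =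
      ∏ x, if f x ∈ S ∧ x ∈ T then G ^ (K * p x) else 1 := by
    intro f
    rw [prX, Finset.mul_sum, Real.rpow_sum_of_pos hG0, Finset.prod_filter]
    exact Finset.prod_congr rfl fun x _ => by split_ifs <;> rfl
  have hfactor : ∀ x, ∑ v : BS m, (if v ∈ S ∧ x ∈ T then G ^ (K * p x) else 1) ≤
      (2 : ℝ) ^ m * exp (p x * (K * (S.card / (2 : ℝ) ^ m * G))) := by
    intro x
    have hpx := hp.1 x
    by_cases hx : x ∈ T
    · have hpow : G ^ (K * p x) ≤ 1 + K * p x * G := by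
        have := rpow_one_add_le_one_add_mul_self (s := G - 1) (by linarith)
          (mul_nonneg hK.le hpx) (hT x hx)
        rw [add_sub_cancel] at this
        nlinarith [mul_nonneg hK.le hpx]
      calc ∑ v : BS m, (if v ∈ S ∧ x ∈ T then G ^ (K * p x) else 1)
          ≤ ∑ v : BS m, (1 + if v ∈ S then K * p x * G else 0) := by
            refine Finset.sum_le_sum fun v _ => ?_
            by_cases hv : v ∈ S <;> simp [hv, hx, hpow]
        _ = (2 : ℝ) ^ m * (p x * (K * (S.card / (2 : ℝ) ^ m * G)) + 1) := by
            rw [Finset.sum_add_distrib]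
            simp
            field_simp
            ring
        _ ≤ _ := mul_le_mul_of_nonneg_left (Real.add_one_le_exp _) hM.le
    · have : (1 : ℝ) ≤ exp (p x * (K * (S.card / (2 : ℝ) ^ m * G))) :=
        Real.one_le_exp (by positivity)
      simpa [hx] using this
  calc ∑ f : BS n → BS m, G ^ (K * prX p (fun x => f x ∈ S ∧ x ∈ T))
      = ∏ x, ∑ v : BS m, (if v ∈ S ∧ x ∈ T then G ^ (K * p x) else 1) := by
        simp_rw [hprod]
        rw [Finset.prod_univ_sum, Fintype.piFinset_univ]
    _ ≤ ∏ x, (2 : ℝ) ^ m * exp (p x * (K * (S.card / (2 : ℝ) ^ m * G))) := by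
        refine Finset.prod_le_prod (fun x _ => Finset.sum_nonneg fun v _ => ?_)
          fun x _ => hfactor x
        split_ifs <;> positivity
    _ = _ := by
        rw [Finset.prod_mul_distrib, ← Real.exp_sum, ← Finset.sum_mul, hp.2, one_mul]
        simp

/-- Chernoff bound for a fixed target set `S`. -/
theorem prF_prX_gt_le {n m : ℕ} {p : BS n → ℝ} {T : Finset (BS n)} (S : Finset (BS m))
    {K G ε : ℝ} (hp : IsDist p) (hK : 0 < K) (hT : ∀ x ∈ T, K * p x ≤ 1) (hG : 1 ≤ G)
    (hε : 0 ≤ ε) :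
    prF n m (fun f => prX p (fun x => f x ∈ S ∧ x ∈ T) > S.card / (2 : ℝ) ^ m * G + ε) ≤
      exp (-(log G - 1) * (K * (S.card / (2 : ℝ) ^ m * G + ε))) := by
  have hG0 : 0 < G := by linarith
  refine (prF_le_of_sum_le (fun f => by positivity)
    (b := G ^ (K * (S.card / (2 : ℝ) ^ m * G + ε))) (by positivity) (fun f hf => ?_)
    (sum_rpow_prX_le S hp hK hT hG)).trans ?_
  · exact Real.rpow_le_rpow_of_exponent_le hG (mul_le_mul_of_nonneg_left hf.le hK.le)
  · rw [Real.rpow_def_of_pos hG0, ← Real.exp_sub]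
    refine Real.exp_le_exp.2 ?_
    nlinarith [mul_nonneg hK.le hε]

/-- Generating function of the sizes of the subsets of `{0,1}^m`. -/
theorem sum_exp_mul_card_le (m : ℕ) (a : ℝ) :
    ∑ S : Finset (BS m), exp (a * S.card) ≤ exp ((2 : ℝ) ^ m * exp a) := by
  have h := Fintype.sum_pow_mul_eq_add_pow (BS m) (exp a) 1
  simp only [one_pow, mul_one] at h
  calc ∑ S : Finset (BS m), exp (a * S.card) = (exp a + 1) ^ Fintype.card (BS m) := by
        rw [← h]
        exact Finset.sum_congr rfl fun S _ => by rw [← Real.exp_nat_mul, mul_comm]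
    _ ≤ exp (exp a) ^ Fintype.card (BS m) :=
        pow_le_pow_left₀ (by positivity) (Real.add_one_le_exp _) _
    _ = _ := by
        rw [← Real.exp_nat_mul]
        simp

/-- a random function condenses the subdistribution on a light set `T`. -/
theorem stmt9 (n m : ℕ) (k ℓ g ε : ℝ) (p : BS n → ℝ) (T : Finset (BS n))
    (hp : IsDist p) (hT : T ⊆ supp p) (hTmax : ∀ x ∈ T, p x ≤ 1 / (2 : ℝ) ^ k)
    (hℓ0 : 0 ≤ ℓ) (hℓk : ℓ ≤ k) (hg : 0 ≤ g) (hm : (m : ℝ) = k - ℓ + g)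
    (hε0 : 0 < ε) (hε1 : ε ≤ 1) :
    prF n m (fun f => ∃ S : Finset (BS m),
        prX p (fun x => f x ∈ S ∧ x ∈ T) >
          ((S.card : ℝ) / (2 : ℝ) ^ (m : ℝ)) * (2 : ℝ) ^ g + ε)
      ≤ (2 : ℝ) ^ (-(ε * (2 : ℝ) ^ k / 2) *
          (g - (1 / (2 : ℝ) ^ ℓ) * Real.logb 2 (2 * Real.exp 1 * (2 : ℝ) ^ g / ε)
            - Real.logb 2 (Real.exp 1))) := by
  have hK : (0 : ℝ) < 2 ^ k := by positivity
  have hL : (1 : ℝ) ≤ 2 ^ ℓ := Real.one_le_rpow (by norm_num) hℓ0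
  have hG : (1 : ℝ) ≤ 2 ^ g := Real.one_le_rpow (by norm_num) hg
  have hMKGL : (2 : ℝ) ^ m * 2 ^ ℓ = 2 ^ k * 2 ^ g := by
    rw [← Real.rpow_natCast, ← Real.rpow_add two_pos, ← Real.rpow_add two_pos, hm]
    congr 1
    ring
  have hlogG : log ((2 : ℝ) ^ g) = g * log 2 := Real.log_rpow two_pos g
  have hlog2 : log 2 ≠ 0 := (Real.log_pos one_lt_two).ne'
  have hrhs : (2 : ℝ) ^ (-(ε * (2 : ℝ) ^ k / 2) *
        (g - (1 / (2 : ℝ) ^ ℓ) * Real.logb 2 (2 * Real.exp 1 * (2 : ℝ) ^ g / ε)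
          - Real.logb 2 (Real.exp 1))) =
      exp (-(ε * (2 : ℝ) ^ k / 2) * ((log ((2 : ℝ) ^ g) - 1) -
        log (2 * exp 1 * (2 : ℝ) ^ g / ε) / (2 : ℝ) ^ ℓ)) := by
    rw [Real.rpow_def_of_pos two_pos, hlogG, Real.logb, Real.logb, Real.log_exp]
    congr 1
    field_simp
    ring
  rw [hrhs]
  have hTK : ∀ x ∈ T, (2 : ℝ) ^ k * p x ≤ 1 := fun x hx => by
    have := hTmax x hx
    rwa [le_div_iff₀ hK, mul_comm] at this
  rw [Real.rpow_natCast]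
  generalize (2 : ℝ) ^ k = K at *
  generalize (2 : ℝ) ^ ℓ = L at *
  generalize (2 : ℝ) ^ g = G at *
  have hL0 : 0 < L := by linarith
  have hG0 : 0 < G := by linarith
  have hM : (0 : ℝ) < 2 ^ m := by positivity
  set h := log G - 1 with hh
  set u := log (2 * exp 1 * G / ε) with hu
  set c := ε * K / 2 with hc
  have hc0 : 0 < c := by positivity
  rcases le_or_gt (h - u / L) 0 with hD | hD
  · exact (prF_le_one _ _ _).trans (Real.one_le_exp (by nlinarith))
  have hu1 : 1 ≤ u := by
    rw [hu, Real.le_log_iff_exp_le (by positivity), le_div_iff₀ hε0]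
    nlinarith [mul_le_mul_of_nonneg_left (hε1.trans hG) (Real.exp_pos 1).le,
      mul_pos (Real.exp_pos 1) hG0]
  have hexp : exp (-h * L) ≤ ε / (2 * exp 1 * G) := by
    have huh : u ≤ h * L := by
      rw [sub_pos, div_lt_iff₀ hL0] at hD
      exact hD.le
    calc exp (-h * L) ≤ exp (-u) := Real.exp_le_exp.2 (by linarith)
      _ = ε / (2 * exp 1 * G) := by
        rw [Real.exp_neg, hu, Real.exp_log (by positivity), inv_div]
  have hMexp : (2 : ℝ) ^ m * exp (-h * L) ≤ c / L := by
    calc (2 : ℝ) ^ m * exp (-h * L) ≤ 2 ^ m * (ε / (2 * exp 1 * G)) :=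
          mul_le_mul_of_nonneg_left hexp hM.le
      _ = c / L / exp 1 := by
          rw [hc, eq_div_of_mul_eq hL0.ne' hMKGL]
          field_simp
      _ ≤ c / L := div_le_self (by positivity) (Real.one_le_exp zero_le_one)
  calc _ ≤ ∑ S : Finset (BS m), exp (-h * (K * (S.card / (2 : ℝ) ^ m * G + ε))) :=
        (prF_exists_le_sum n m _).trans
          (Finset.sum_le_sum fun S _ => prF_prX_gt_le S hp hK hTK hG hε0.le)
    _ = exp (-(2 * c * h)) * ∑ S : Finset (BS m), exp (-h * L * S.card) := by
        rw [Finset.mul_sum]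
        refine Finset.sum_congr rfl fun S _ => ?_
        rw [← Real.exp_add, hc]
        congr 1
        field_simp
        linear_combination (S.card : ℝ) * h * hMKGL
    _ ≤ exp (-(2 * c * h)) * exp (c / L) := by
        refine mul_le_mul_of_nonneg_left ?_ (Real.exp_pos _).le
        exact (sum_exp_mul_card_le m _).trans (Real.exp_le_exp.2 hMexp)
    _ ≤ exp (-c * (h - u / L)) := by
        rw [← Real.exp_add]
        refine Real.exp_le_exp.2 ?_
        have h1 : 1 / L ≤ u / L := div_le_div_of_nonneg_right hu1 hL0.le
        have h2 : 1 / L ≤ h + u / L := by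
          have : 0 ≤ u / L := by positivity
          linarith
        have h3 := mul_le_mul_of_nonneg_left h2 hc0.le
        rw [mul_one_div] at h3
        linarith
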